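/- Let 𝒜 be a full rank supersolvable line arrangement in the real projective plane ℙ²(ℝ). Then |Sing₂(𝒜)| + m(𝒜) ≥ |𝒜|. -/

import Mathlib

open scoped Classical

/-- A point of the projective plane over `K`. -/
abbrev Pt (K : Type*) [Field K] := Projectivization K (Fin 3 → K)

/-- A (candidate) line arrangement: a finite set of linear subspaces of `K³`. -/
abbrev Arr (K : Type*) [Field K] := Finset (Submodule K (Fin 3 → K))

/-- Every member of `A` is a projective line, i.e. a 2-dimensional linear subspace of `K³`. -/
def IsLineArr {K : Type*} [Field K] (A : Arr K) : Prop :=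
  ∀ L ∈ A, Module.finrank K L = 2

/-- The multiplicity `m(P, A)`: the number of lines of `A` passing through `P`. -/
noncomputable def multAt {K : Type*} [Field K] (A : Arr K) (P : Pt K) : ℕ :=
  (A.filter fun L => P.submodule ≤ L).card

/-- `Sing(A)`: the set of points lying on at least two lines of `A`. -/
def SingSet {K : Type*} [Field K] (A : Arr K) : Set (Pt K) :=
  {P | 2 ≤ multAt A P}

/-- `Sing₂(A)`: the set of simple points, i.e. singular points of multiplicity exactly 2. -/
def Sing2Set {K : Type*} [Field K] (A : Arr K) : Set (Pt K) :=
  {P | multAt A P = 2}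

/-- `m(A)`: the maximum multiplicity of a singular point of `A`. -/
noncomputable def maxMult {K : Type*} [Field K] (A : Arr K) : ℕ :=
  sSup (multAt A '' SingSet A)

/-- `P` is a modular point of `A`: it is singular, and for every other singular point `Q`
the line through `P` and `Q` belongs to `A`. -/
def IsModular {K : Type*} [Field K] (A : Arr K) (P : Pt K) : Prop :=
  P ∈ SingSet A ∧ ∀ Q ∈ SingSet A, Q ≠ P → (P.submodule ⊔ Q.submodule) ∈ A

/-- `A` is supersolvable: it has a modular point. -/
def Supersolvable {K : Type*} [Field K] (A : Arr K) : Prop :=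
  ∃ P, IsModular A P

/-- `A` has full rank (rank 3): its lines have no common point. -/
def FullRank {K : Type*} [Field K] (A : Arr K) : Prop :=
  (⨅ L ∈ A, L) = ⊥

/-- A finite chain in a product of two linear orders has fewer elements than its two
projections together. -/
lemma card_add_one_le_of_chain {ι : Type*} {S : Finset ι} (hS : S.Nonempty) (x y : ι → ℝ)
    (hinj : ∀ i ∈ S, ∀ j ∈ S, x i = x j → y i = y j → i = j)
    (hmono : ∀ i ∈ S, ∀ j ∈ S, x i < x j → y i ≤ y j) :
    S.card + 1 ≤ (S.image x).card + (S.image y).card := by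
  have hlt (z : ι → ℝ) (i j : ι) (hi : i ∈ S) (h : z i < z j) :
      ((S.image z).filter (· < z i)).card < ((S.image z).filter (· < z j)).card := by
    apply Finset.card_lt_card
    refine Finset.ssubset_iff_subset_ne.2 ⟨?_, fun he => ?_⟩
    · exact Finset.monotone_filter_right _ fun t _ ht => lt_trans ht h
    · have : z i ∈ (S.image z).filter (· < z j) := by
        simpa [h] using ⟨i, hi, rfl⟩
      rw [← he] at this
      simp at this
  have hle (z : ι → ℝ) (i j : ι) (hi : i ∈ S) (h : z i ≤ z j) :
      ((S.image z).filter (· < z i)).card ≤ ((S.image z).filter (· < z j)).card := by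
    rcases h.lt_or_eq with h | h
    · exact (hlt z i j hi h).le
    · rw [h]
  have hrank (z : ι → ℝ) (i : ι) (hi : i ∈ S) :
      ((S.image z).filter (· < z i)).card < (S.image z).card := by
    apply Finset.card_lt_card
    refine Finset.filter_ssubset.2 ⟨z i, Finset.mem_image_of_mem _ hi, by simp⟩
  set g : ι → ℕ := fun i => ((S.image x).filter (· < x i)).card +
    ((S.image y).filter (· < y i)).card with hg
  have hginj : Set.InjOn g S := by
    intro i hi j hj hij
    simp only [Finset.mem_coe] at hi hj
    simp only [hg] at hij
    rcases lt_trichotomy (x i) (x j) with h | h | h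
    · have h1 := hlt x i j hi h
      have h2 := hle y i j hi (hmono i hi j hj h)
      omega
    · rcases lt_trichotomy (y i) (y j) with h' | h' | h'
      · have h1 := hle x i j hi h.le
        have h2 := hlt y i j hi h'
        omega
      · exact hinj i hi j hj h h'
      · have h1 := hle x j i hj h.ge
        have h2 := hlt y j i hj h'
        omega
    · have h1 := hlt x j i hj h
      have h2 := hle y j i hj (hmono j hj i hi h)
      omega
  have hcard := Finset.card_le_card_of_injOn (t := Finset.range
    ((S.image x).card + (S.image y).card - 1)) g (fun i hi => by
      have h1 := hrank x i hi
      have h2 := hrank y i hi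
      simp only [hg, Finset.coe_range, Set.mem_Iio]
      omega) hginj
  obtain ⟨i, hi⟩ := hS
  have h1 := hrank x i hi
  rw [Finset.card_range] at hcard
  omega

/-- If the graphs of affine functions meet pairwise over the finite set `T`, the average number of
values taken at a point of `T` is at least half of one more than the number of functions. -/
lemma card_mul_le_two_mul_sum_card_image {ι : Type*} {S : Finset ι} (hS : S.Nonempty)
    (u v : ι → ℝ) {T : Finset ℝ} (hT : 2 ≤ T.card)
    (hv : ∀ i ∈ S, ∀ j ∈ S, i ≠ j → v i ≠ v j)
    (hmeet : ∀ i ∈ S, ∀ j ∈ S, i ≠ j → ∃ a ∈ T, u i + a * v i = u j + a * v j) :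
    T.card * (S.card + 1) ≤ 2 * ∑ a ∈ T, (S.image fun i => u i + a * v i).card := by
  obtain ⟨n, hn⟩ : ∃ n, T.card = n + 2 := ⟨T.card - 2, by omega⟩
  set e := T.orderIsoOfFin hn
  set B : Fin (n + 2) → ℕ := fun j => (S.image fun i => u i + (e j : ℝ) * v i).card with hB
  have hinj : ∀ a b : ℝ, a ≠ b → ∀ i ∈ S, ∀ j ∈ S, u i + a * v i = u j + a * v j →
      u i + b * v i = u j + b * v j → i = j := by
    intro a b hab i hi j hj h1 h2
    by_contra hij
    have h3 : (a - b) * (v i - v j) = 0 := by linarith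
    rcases mul_eq_zero.1 h3 with h | h
    · exact hab (by linarith)
    · exact hv i hi j hj hij (by linarith)
  have hstep : ∀ j, S.card + 1 ≤ B j + B (j + 1) := by
    intro j
    by_cases hj : j = Fin.last (n + 1)
    · have hne : ((e j : T) : ℝ) ≠ e (j + 1) := by
        intro h
        have := e.injective (Subtype.ext h)
        subst hj
        simp [Fin.ext_iff] at this
      have h := card_add_one_le_of_chain hS (fun i => u i + (e j : ℝ) * v i)
        (fun i => -(u i + (e (j + 1) : ℝ) * v i))
        (fun i hi k hk h1 h2 => hinj _ _ hne i hi k hk h1 (neg_injective h2)) (by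
          intro i hi k hk hik
          have hne' : i ≠ k := by rintro rfl; exact lt_irrefl _ hik
          obtain ⟨a, ha, hak⟩ := hmeet i hi k hk hne'
          obtain ⟨l, hl⟩ := e.surjective ⟨a, ha⟩
          have hla : (e l : ℝ) = a := by rw [hl]
          have h1 : a ≤ e j := by
            rw [← hla]; exact_mod_cast e.monotone (hj ▸ Fin.le_last l)
          have h2 : (e (j + 1) : ℝ) ≤ a := by
            rw [← hla]
            have : j + 1 ≤ l := by subst hj; simp
            exact_mod_cast e.monotone this
          have h3 : ((e j : ℝ) - a) * (v i - v k) < 0 := by linarith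
          have h4 : v i - v k < 0 := by
            by_contra h5
            nlinarith [mul_nonneg (sub_nonneg.2 h1) (not_lt.1 h5)]
          nlinarith [mul_nonneg (sub_nonneg.2 h2) (neg_nonneg.2 h4.le)])
      have himg : (S.image fun i => -(u i + (e (j + 1) : ℝ) * v i)).card = B (j + 1) := by
        rw [← Finset.card_image_of_injective _ (neg_injective (G := ℝ)), Finset.image_image]
        simp [hB, Function.comp_def]
      rw [himg] at h
      exact h
    · have hlt : j < j + 1 := by
        rw [Fin.lt_add_one_iff]; exact Fin.lt_last_iff_ne_last.2 hj
      have hlt' : (e j : ℝ) < e (j + 1) := by exact_mod_cast e.strictMono hlt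
      refine card_add_one_le_of_chain hS (fun i => u i + (e j : ℝ) * v i)
        (fun i => (u i + (e (j + 1) : ℝ) * v i)) (hinj _ _ hlt'.ne) ?_
      intro i hi k hk hik
      have hne' : i ≠ k := by rintro rfl; exact lt_irrefl _ hik
      obtain ⟨a, ha, hak⟩ := hmeet i hi k hk hne'
      obtain ⟨l, hl⟩ := e.surjective ⟨a, ha⟩
      have hla : (e l : ℝ) = a := by rw [hl]
      have h3 : ((e j : ℝ) - a) * (v i - v k) < 0 := by linarith
      by_contra! h4
      have h5 : 0 < ((e (j + 1) : ℝ) - a) * (v i - v k) := by linarith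
      have h6 : l ≤ j ∨ j + 1 ≤ l := by
        rcases le_or_gt l j with h | h
        · exact Or.inl h
        · right
          rw [Fin.le_def, Fin.val_add_one_of_lt (Fin.lt_last_iff_ne_last.2 hj)]
          exact h
      rcases h6 with h6 | h6
      · have h7 : a ≤ e j := by rw [← hla]; exact_mod_cast e.monotone h6
        have h8 : v i - v k < 0 := by
          by_contra h9
          nlinarith [mul_nonneg (sub_nonneg.2 h7) (not_lt.1 h9)]
        nlinarith
      · have h7 : (e (j + 1) : ℝ) ≤ a := by rw [← hla]; exact_mod_cast e.monotone h6
        have h8 : v i - v k < 0 := by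
          by_contra h9
          nlinarith [mul_nonneg (sub_nonneg.2 h7) (not_lt.1 h9)]
        nlinarith
  have hsum : ∑ a ∈ T, (S.image fun i => u i + a * v i).card = ∑ j, B j := by
    rw [← Finset.sum_coe_sort T, ← e.toEquiv.sum_comp]
    rfl
  have hshift : ∑ j, B (j + 1) = ∑ j, B j := 
    Equiv.sum_comp (Equiv.addRight (1 : Fin (n + 2))) B
  calc T.card * (S.card + 1) = ∑ _j : Fin (n + 2), (S.card + 1) := by simp [hn]
    _ ≤ ∑ j, (B j + B (j + 1)) := Finset.sum_le_sum fun j _ => hstep j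
    _ = 2 * ∑ a ∈ T, (S.image fun i => u i + a * v i).card := by
      rw [Finset.sum_add_distrib, hshift, hsum, two_mul]

/-- If the graphs of affine functions meet pairwise over the finite set `T`, there are at least as
many points over `T` lying on a single graph as there are functions. -/
lemma card_le_sum_card_unique_values {ι : Type*} (S : Finset ι)
    (u v : ι → ℝ) {T : Finset ℝ} (hT : 2 ≤ T.card)
    (hv : ∀ i ∈ S, ∀ j ∈ S, i ≠ j → v i ≠ v j)
    (hmeet : ∀ i ∈ S, ∀ j ∈ S, i ≠ j → ∃ a ∈ T, u i + a * v i = u j + a * v j) :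
    S.card ≤ ∑ a ∈ T, ((S.image fun i => u i + a * v i).filter fun y =>
      (S.filter fun i => u i + a * v i = y).card = 1).card := by
  rcases S.eq_empty_or_nonempty with rfl | hS
  · simp
  set N : ℝ → ℝ → ℕ := fun a y => (S.filter fun i => u i + a * v i = y).card with hN
  set Y : ℝ → Finset ℝ := fun a => S.image fun i => u i + a * v i with hY
  have hB := card_mul_le_two_mul_sum_card_image hS u v hT hv hmeet
  have hsum1 (a : ℝ) : ∑ y ∈ Y a, N a y = S.card := by
    have := Finset.sum_comp (s := S) (fun _ : ℝ => 1) (fun i => u i + a * v i)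
    simpa using this.symm
  have hsum2 (a : ℝ) : ∑ y ∈ Y a, N a y * N a y = ∑ i ∈ S, N a (u i + a * v i) := by
    have := Finset.sum_comp (s := S) (N a) (fun i => u i + a * v i)
    simpa using this.symm
  have hpairs : S.card * (T.card + (S.card - 1)) ≤ ∑ a ∈ T, ∑ y ∈ Y a, N a y * N a y := by
    calc S.card * (T.card + (S.card - 1))
        = ∑ i ∈ S, (T.card + ∑ j ∈ S.erase i, 1) := by
          rw [Finset.card_eq_sum_ones, Finset.sum_mul]
          refine Finset.sum_congr rfl fun i hi => ?_
          simp [Finset.card_erase_of_mem hi]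
      _ ≤ ∑ i ∈ S, ∑ j ∈ S, (T.filter fun a => u j + a * v j = u i + a * v i).card := by
          refine Finset.sum_le_sum fun i hi => ?_
          rw [← Finset.add_sum_erase _ _ hi]
          refine Nat.add_le_add (by simp) (Finset.sum_le_sum fun j hj => ?_)
          obtain ⟨a, ha, h⟩ := hmeet j (Finset.mem_of_mem_erase hj) i hi (Finset.ne_of_mem_erase hj)
          exact Finset.card_pos.2 ⟨a, Finset.mem_filter.2 ⟨ha, h⟩⟩
      _ = ∑ a ∈ T, ∑ y ∈ Y a, N a y * N a y := by
          simp_rw [hsum2, hN, Finset.card_filter]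
          rw [Finset.sum_comm (s := T)]
          exact Finset.sum_congr rfl fun i _ => Finset.sum_comm
  have hpoint (a : ℝ) (y : ℝ) (hy : y ∈ Y a) :
      (N a y * N a y : ℤ) - 2 * N a y ≤
        S.card * N a y - 2 * S.card + (S.card - 1) * (if N a y = 1 then 1 else 0) := by
    have h1 : N a y ≤ S.card := Finset.card_filter_le _ _
    have h2 : 1 ≤ N a y := by
      obtain ⟨i, hi, hiy⟩ := Finset.mem_image.1 hy
      exact Finset.card_pos.2 ⟨i, Finset.mem_filter.2 ⟨hi, hiy⟩⟩
    split_ifs with h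
    · rw [h]; push_cast; linarith
    · have h3 : (2 : ℤ) ≤ N a y := by exact_mod_cast (by omega : 2 ≤ N a y)
      have h4 : (N a y : ℤ) ≤ S.card := by exact_mod_cast h1
      nlinarith
  have htotal := Finset.sum_le_sum fun a (_ : a ∈ T) => Finset.sum_le_sum (hpoint a)
  simp only [Finset.sum_add_distrib, Finset.sum_sub_distrib, ← Finset.mul_sum,
    Finset.sum_const] at htotal
  have hs (a : ℝ) : (∑ y ∈ Y a, (if N a y = 1 then 1 else 0 : ℤ)) =
      (((Y a).filter fun y => N a y = 1).card : ℤ) := by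
    rw [Finset.card_filter]; push_cast; rfl
  have hsum1' (a : ℝ) : ∑ y ∈ Y a, (N a y : ℤ) = S.card := by exact_mod_cast hsum1 a
  simp only [hs, hsum1', Finset.sum_const, nsmul_eq_mul, ← Finset.sum_mul] at htotal
  have hk : 1 ≤ S.card := hS.card_pos
  change S.card ≤ ∑ a ∈ T, ((Y a).filter fun y => N a y = 1).card
  rcases hk.eq_or_lt with hk1 | hk2
  · obtain ⟨i, rfl⟩ := Finset.card_eq_one.1 hk1.symm
    simp only [hY, hN, Finset.image_singleton, Finset.filter_singleton, Finset.card_singleton,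
      if_true, Finset.sum_const, smul_eq_mul, mul_one]
    omega
  · have hB' : (T.card * (S.card + 1) : ℤ) ≤ 2 * ∑ a ∈ T, ((Y a).card : ℤ) := by
      exact_mod_cast hB
    zify [hk] at hpairs
    rw [← Nat.cast_le (α := ℤ), Nat.cast_sum]
    have hk2' : (2 : ℤ) ≤ S.card := by exact_mod_cast hk2
    have h1 := mul_le_mul_of_nonneg_left hB' (by linarith : (0 : ℤ) ≤ S.card)
    refine le_of_mul_le_mul_left (a := (S.card - 1 : ℤ)) ?_ (by linarith)
    linarith

lemma span_pair_eq_of_finrank_eq_two {L : Submodule ℝ (Fin 3 → ℝ)} (hL : Module.finrank ℝ L = 2)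
    {x y : Fin 3 → ℝ} (hx : x ∈ L) (hy : y ∈ L)
    (hxy : ∀ a b : ℝ, a • x + b • y = 0 → a = 0 ∧ b = 0) :
    Submodule.span ℝ {x, y} = L := by
  have hli : LinearIndependent ℝ ![x, y] := LinearIndependent.pair_iff.2 hxy
  have hfin := finrank_span_eq_card hli
  rw [Matrix.range_cons_cons_empty] at hfin
  refine Submodule.eq_of_le_of_finrank_eq (Submodule.span_le.2 ?_) (by simp [hfin, hL])
  rintro z (rfl | rfl) <;> assumption

lemma exists_add_smul_mem {L : Submodule ℝ (Fin 3 → ℝ)} (hL : Module.finrank ℝ L = 2)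
    {p : Fin 3 → ℝ} (hp : p ∉ L) (x : Fin 3 → ℝ) : ∃ c : ℝ, x + c • p ∈ L := by
  have hlt : L < L ⊔ Submodule.span ℝ {p} := by
    refine lt_of_le_not_ge le_sup_left fun h => hp (h ?_)
    exact Submodule.mem_sup_right (Submodule.mem_span_singleton_self p)
  have htop : L ⊔ Submodule.span ℝ {p} = ⊤ := by
    apply Submodule.eq_top_of_finrank_eq
    have h1 := Submodule.finrank_lt_finrank_of_lt hlt
    have h2 := Submodule.finrank_le (L ⊔ Submodule.span ℝ {p})
    rw [Module.finrank_fin_fun] at h2 ⊢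
    omega
  obtain ⟨l, hl, z, hz, hx⟩ := Submodule.mem_sup.1 (htop ▸ Submodule.mem_top : x ∈ _)
  obtain ⟨c, rfl⟩ := Submodule.mem_span_singleton.1 hz
  exact ⟨-c, by rw [← hx]; simpa using hl⟩

lemma exists_ne_zero_mem_inf {L M : Submodule ℝ (Fin 3 → ℝ)} (hL : Module.finrank ℝ L = 2)
    (hM : Module.finrank ℝ M = 2) : ∃ x ∈ L ⊓ M, x ≠ 0 := by
  apply Submodule.exists_mem_ne_zero_of_ne_bot
  intro h
  have h1 := Submodule.finrank_sup_add_finrank_inf_eq L M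
  have h2 := Submodule.finrank_le (L ⊔ M)
  rw [Module.finrank_fin_fun] at h2
  rw [h, finrank_bot] at h1
  omega

/-- A nonzero vector extends to a basis whose second vector avoids all the given lines. -/
lemma exists_frame {A : Arr ℝ} (hA : IsLineArr A) {p : Fin 3 → ℝ} (hp : p ≠ 0) :
    ∃ q r : Fin 3 → ℝ, (∀ L ∈ A, q ∉ L) ∧
      (∀ a b c : ℝ, a • p + b • q + c • r = 0 → a = 0 ∧ b = 0 ∧ c = 0) ∧
      ∀ x, ∃ a b c : ℝ, x = a • p + b • q + c • r := by
  have hp1 : Module.finrank ℝ (Submodule.span ℝ {p}) = 1 := finrank_span_singleton hp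
  have htop : (⊤ : Submodule ℝ (Fin 3 → ℝ)) ∉ insert (Submodule.span ℝ {p}) A := by
    intro h
    have h3 : Module.finrank ℝ (⊤ : Submodule ℝ (Fin 3 → ℝ)) = 3 := by simp
    rcases Finset.mem_insert.1 h with h | h
    · rw [h, hp1] at h3; omega
    · have := hA _ h; omega
  have hcov := Subspace.biUnion_ne_univ_of_top_notMem htop
  obtain ⟨q, hq⟩ := (Set.ne_univ_iff_exists_notMem _).1 hcov
  simp only [Set.mem_iUnion, Finset.mem_insert, SetLike.mem_coe, not_exists] at hq
  have hli2 : LinearIndependent ℝ ![q, p] := by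
    refine linearIndependent_finCons.2 ⟨LinearIndependent.of_subsingleton (v := ![p]) 0
      (by simpa using hp), ?_⟩
    simpa using hq _ (Or.inl rfl)
  obtain ⟨r, hr⟩ : ∃ r, r ∉ Submodule.span ℝ (Set.range ![q, p]) := by
    by_contra! h
    have h1 := finrank_span_eq_card hli2
    rw [Submodule.eq_top_iff'.2 h] at h1
    simp at h1
  have hli : LinearIndependent ℝ ![r, q, p] := linearIndependent_finCons.2 ⟨hli2, hr⟩
  refine ⟨q, r, fun L hL => hq L (Or.inr hL), fun a b c h => ?_, fun x => ?_⟩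
  · have := Fintype.linearIndependent_iff.1 hli ![c, b, a] (by
      simp only [Fin.sum_univ_three]
      simp only [Matrix.cons_val]
      rw [← h]; abel)
    exact ⟨this 2, this 1, this 0⟩
  · have hx : x ∈ Submodule.span ℝ (Set.range ![r, q, p]) := by
      rw [hli.span_eq_top_of_card_eq_finrank (by simp)]
      exact Submodule.mem_top
    obtain ⟨c, hc⟩ := (Submodule.mem_span_range_iff_exists_fun ℝ).1 hx
    refine ⟨c 2, c 1, c 0, ?_⟩
    rw [← hc, Fin.sum_univ_three]
    simp only [Matrix.cons_val]
    abel

lemma finite_sing2Set {A : Arr ℝ} (hA : IsLineArr A) : (Sing2Set A).Finite := by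
  refine Set.Finite.of_injOn (f := fun P : Pt ℝ => A.filter fun L => P.submodule ≤ L)
    (t := (A.powerset : Set (Arr ℝ)))
    (fun P _ => Finset.mem_coe.2 (Finset.mem_powerset.2 (Finset.filter_subset _ _))) ?_
    (Finset.finite_toSet _)
  intro P hP Q _ hPQ
  obtain ⟨L, M, hLM, h⟩ := Finset.card_eq_two.1 hP
  have hinf (R : Pt ℝ) (hR : (A.filter fun L => R.submodule ≤ L) = {L, M}) :
      R.submodule = L ⊓ M := by
    have hL : L ∈ A.filter fun L => R.submodule ≤ L := by simp [hR]
    have hM : M ∈ A.filter fun L => R.submodule ≤ L := by simp [hR]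
    rw [Finset.mem_filter] at hL hM
    refine Submodule.eq_of_le_of_finrank_le (le_inf hL.2 hM.2) ?_
    rw [R.finrank_submodule]
    have hlt : L ⊓ M < L := by
      refine lt_of_le_of_ne inf_le_left fun he => hLM ?_
      exact Submodule.eq_of_le_of_finrank_eq (inf_eq_left.1 he)
        ((hA L hL.1).trans (hA M hM.1).symm)
    have := Submodule.finrank_lt_finrank_of_lt hlt
    rw [hA L hL.1] at this
    omega
  apply Projectivization.submodule_injective
  rw [hinf P h, hinf Q (by rw [← h]; exact hPQ.symm)]

lemma multAt_le_maxMult {A : Arr ℝ} {P : Pt ℝ} (hP : P ∈ SingSet A) :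
    multAt A P ≤ maxMult A := by
  refine le_csSup ⟨A.card, ?_⟩ ⟨P, hP, rfl⟩
  rintro _ ⟨Q, _, rfl⟩
  exact Finset.card_filter_le _ _

lemma mk_submodule_le_iff {x : Fin 3 → ℝ} (hx : x ≠ 0) (L : Submodule ℝ (Fin 3 → ℝ)) :
    (Projectivization.mk ℝ x hx).submodule ≤ L ↔ x ∈ L := by
  rw [Projectivization.submodule_mk, Submodule.span_singleton_le_iff_mem]

/-- The number of simple points is at least the number of lines missing a given modular point. -/
lemma card_le_ncard_sing2_add_multAt {A : Arr ℝ} (hA : IsLineArr A) {P : Pt ℝ}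
    (hP : IsModular A P) : A.card ≤ (Sing2Set A).ncard + multAt A P := by
  obtain ⟨p, hp, rfl⟩ : ∃ p, ∃ hp : p ≠ 0, P = Projectivization.mk ℝ p hp :=
    ⟨P.rep, P.rep_nonzero, P.mk_rep.symm⟩
  obtain ⟨q, r, hq, hind, hspan⟩ := exists_frame hA hp
  set V : ℝ → Submodule ℝ (Fin 3 → ℝ) := fun a => Submodule.span ℝ {p, r + a • q} with hV
  have hpV (a : ℝ) : p ∈ V a := Submodule.subset_span (by simp)
  have hrV (a : ℝ) : r + a • q ∈ V a := Submodule.subset_span (by simp)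
  have hVinj : Function.Injective V := by
    intro a b hab
    have h : r + a • q ∈ V b := hab ▸ hrV a
    obtain ⟨x, y, hxy⟩ := Submodule.mem_span_pair.1 h
    obtain ⟨-, h1, h2⟩ := hind x (y * b - a) (y - 1) (by
      rw [← sub_eq_zero] at hxy
      rw [← hxy]; module)
    have h3 : y = 1 := by linarith
    rw [h3] at h1
    linarith
  have hVeq {L : Submodule ℝ (Fin 3 → ℝ)} (hL : L ∈ A) (hpL : p ∈ L) {a : ℝ}
      (ha : r + a • q ∈ L) : V a = L := by
    refine span_pair_eq_of_finrank_eq_two (hA L hL) hpL ha fun x y hxy => ?_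
    obtain ⟨h1, -, h2⟩ := hind x (y * a) y (by rw [← hxy]; module)
    exact ⟨h1, h2⟩
  -- A vector of a line through `p` that is not proportional to `p` has a nonzero `r`-coordinate.
  have hcoord {L : Submodule ℝ (Fin 3 → ℝ)} (hL : L ∈ A) (hpL : p ∈ L) {a b c : ℝ}
      (hx : a • p + b • q + c • r ∈ L) (hbc : b ≠ 0 ∨ c ≠ 0) :
      c ≠ 0 ∧ V (b / c) = L := by
    have h1 : b • q + c • r ∈ L := by
      have := L.sub_mem hx (L.smul_mem a hpL)
      convert this using 1; module
    have hc : c ≠ 0 := by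
      rintro rfl
      have hb : b ≠ 0 := by simpa using hbc
      refine hq L hL ?_
      rwa [zero_smul, add_zero, L.smul_mem_iff hb] at h1
    refine ⟨hc, hVeq hL hpL ?_⟩
    have := L.smul_mem c⁻¹ h1
    convert this using 1
    rw [smul_add, smul_smul, smul_smul, inv_mul_cancel₀ hc, one_smul, div_eq_inv_mul, add_comm]
  set T : Finset ℝ := A.preimage V hVinj.injOn with hTdef
  have hT : T.card = (A.filter fun L => p ∈ L).card := by
    rw [← Finset.card_image_of_injective T hVinj]
    congr 1
    ext L
    simp only [Finset.mem_image, Finset.mem_filter, hTdef, Finset.mem_preimage]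
    constructor
    · rintro ⟨a, ha, rfl⟩
      exact ⟨ha, hpV a⟩
    · rintro ⟨hL, hpL⟩
      obtain ⟨x, hx, hxp⟩ : ∃ x ∈ L, x ∉ Submodule.span ℝ {p} := by
        by_contra! h
        have := Submodule.finrank_mono (show L ≤ Submodule.span ℝ {p} from h)
        rw [hA L hL, finrank_span_singleton hp] at this
        omega
      obtain ⟨a, b, c, rfl⟩ := hspan x
      obtain ⟨-, h⟩ := hcoord hL hpL hx (by
        by_contra! h
        refine hxp (Submodule.mem_span_singleton.2 ⟨a, ?_⟩)
        simp [h.1, h.2])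
      exact ⟨_, h ▸ hL, h⟩
  have hmult : multAt A (Projectivization.mk ℝ p hp) = T.card := by
    simp only [multAt, mk_submodule_le_iff, hT]
  have hT2 : 2 ≤ T.card := hmult ▸ hP.1
  set S : Arr ℝ := A.filter fun L => p ∉ L with hS
  have hcard : A.card = S.card + T.card := by
    rw [hT, hS, add_comm, Finset.card_filter_add_card_filter_not]
  have hex : ∀ (L : Submodule ℝ (Fin 3 → ℝ)) (x : Fin 3 → ℝ), ∃ c : ℝ, L ∈ S → x + c • p ∈ L := by
    intro L x
    by_cases hL : L ∈ S
    · obtain ⟨hLA, hpL⟩ := Finset.mem_filter.1 hL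
      obtain ⟨c, hc⟩ := exists_add_smul_mem (hA L hLA) hpL x
      exact ⟨c, fun _ => hc⟩
    · exact ⟨0, fun h => absurd h hL⟩
  choose f hf using hex
  have hval {L : Submodule ℝ (Fin 3 → ℝ)} (hL : L ∈ S) (a y : ℝ) :
      r + a • q + y • p ∈ L ↔ f L r + a * f L q = y := by
    have h1 : r + a • q + (f L r + a * f L q) • p ∈ L := by
      convert L.add_mem (hf L r hL) (L.smul_mem a (hf L q hL)) using 1
      module
    constructor
    · intro h2
      by_contra hne
      refine (Finset.mem_filter.1 hL).2 ((L.smul_mem_iff (sub_ne_zero.2 hne)).1 ?_)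
      convert L.sub_mem h1 h2 using 1
      module
    · rintro rfl
      exact h1
  have hmeet : ∀ L ∈ S, ∀ M ∈ S, L ≠ M → ∃ a ∈ T, f L r + a * f L q = f M r + a * f M q := by
    intro L hL M hM hLM
    obtain ⟨hLA, hpL⟩ := Finset.mem_filter.1 hL
    obtain ⟨hMA, hpM⟩ := Finset.mem_filter.1 hM
    obtain ⟨x, ⟨hxL, hxM⟩, hx0⟩ := exists_ne_zero_mem_inf (hA L hLA) (hA M hMA)
    have hsing : Projectivization.mk ℝ x hx0 ∈ SingSet A := by
      rw [SingSet, Set.mem_ofPred_eq, multAt, ← Finset.card_pair hLM]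
      refine Finset.card_le_card ?_
      intro N hN
      rw [Finset.mem_filter, mk_submodule_le_iff]
      rcases Finset.mem_insert.1 hN with rfl | hN
      · exact ⟨hLA, hxL⟩
      · rw [Finset.mem_singleton.1 hN]
        exact ⟨hMA, hxM⟩
    have hne : Projectivization.mk ℝ x hx0 ≠ Projectivization.mk ℝ p hp := by
      intro h
      refine hpL ((mk_submodule_le_iff hp L).1 ?_)
      rw [← h, mk_submodule_le_iff]
      exact hxL
    have hN := hP.2 _ hsing hne
    have hpN := (mk_submodule_le_iff hp _).1
      (le_sup_left (b := (Projectivization.mk ℝ x hx0).submodule))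
    have hxN := (mk_submodule_le_iff hx0 _).1
      (le_sup_right (a := (Projectivization.mk ℝ p hp).submodule))
    obtain ⟨a, b, c, rfl⟩ := hspan x
    obtain ⟨hc, hVN⟩ := hcoord hN hpN hxN (by
      by_contra! h
      rw [h.1, h.2, zero_smul, zero_smul, add_zero, add_zero] at hxL hx0
      exact hpL ((L.smul_mem_iff (fun ha => hx0 (by rw [ha, zero_smul]))).1 hxL))
    refine ⟨b / c, by rw [hTdef, Finset.mem_preimage, hVN]; exact hN, ?_⟩
    have hscale : r + (b / c) • q + (a / c) • p = c⁻¹ • (a • p + b • q + c • r) := by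
      rw [smul_add, smul_add, smul_smul, smul_smul, smul_smul, inv_mul_cancel₀ hc, one_smul,
        div_eq_inv_mul, div_eq_inv_mul]
      abel
    rw [(hval hL _ (a / c)).1 (hscale ▸ L.smul_mem _ hxL),
      (hval hM _ (a / c)).1 (hscale ▸ M.smul_mem _ hxM)]
  have hslope : ∀ L ∈ S, ∀ M ∈ S, L ≠ M → f L q ≠ f M q := by
    intro L hL M hM hLM hv
    obtain ⟨a, -, ha⟩ := hmeet L hL M hM hLM
    have hu : f L r = f M r := by rw [hv] at ha; linarith
    have hli (s t : ℝ) : ∀ x y : ℝ, x • (r + s • p) + y • (q + t • p) = 0 → x = 0 ∧ y = 0 := by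
      intro x y hxy
      obtain ⟨-, h1, h2⟩ := hind (x * s + y * t) y x (by rw [← hxy]; module)
      exact ⟨h2, h1⟩
    have h1 := span_pair_eq_of_finrank_eq_two (hA L (Finset.mem_filter.1 hL).1) (hf L r hL)
      (hf L q hL) (hli _ _)
    have h2 := span_pair_eq_of_finrank_eq_two (hA M (Finset.mem_filter.1 hM).1) (hf M r hM)
      (hf M q hM) (hli _ _)
    rw [hu, hv] at h1
    exact hLM (h1.symm.trans h2)
  have hmain := card_le_sum_card_unique_values S (fun L => f L r) (fun L => f L q) hT2 hslope hmeet
  rw [← Finset.card_sigma] at hmain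
  have hpt (a y : ℝ) : r + a • q + y • p ≠ 0 := by
    intro h
    obtain ⟨-, -, h1⟩ := hind y a 1 (by rw [← h]; module)
    exact one_ne_zero h1
  rw [hcard, hmult]
  refine Nat.add_le_add_right (hmain.trans ?_) _
  rw [← Set.ncard_coe_finset]
  refine Set.ncard_le_ncard_of_injOn
    (fun z : Σ _ : ℝ, ℝ => Projectivization.mk ℝ (r + z.1 • q + z.2 • p) (hpt _ _)) ?_ ?_
    (finite_sing2Set hA)
  · rintro ⟨a, y⟩ hz
    simp only [Finset.coe_sigma, Set.mem_sigma_iff, Finset.mem_coe, Finset.mem_filter] at hz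
    obtain ⟨haT, -, hy⟩ := hz
    obtain ⟨M, hM⟩ := Finset.card_eq_one.1 hy
    have hMmem : M ∈ S ∧ f M r + a * f M q = y :=
      Finset.mem_filter.1 (hM ▸ Finset.mem_singleton_self M)
    have hne : V a ≠ M := by
      rintro rfl
      exact (Finset.mem_filter.1 hMmem.1).2 (hpV a)
    rw [Sing2Set, Set.mem_ofPred_eq, multAt, ← Finset.card_pair hne]
    congr 1
    ext L
    simp only [Finset.mem_filter, mk_submodule_le_iff, Finset.mem_insert, Finset.mem_singleton]
    constructor
    · rintro ⟨hL, hx⟩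
      by_cases hpL : p ∈ L
      · left
        refine (hVeq hL hpL ?_).symm
        simpa using L.sub_mem hx (L.smul_mem y hpL)
      · right
        have hLS : L ∈ S := Finset.mem_filter.2 ⟨hL, hpL⟩
        rw [← Finset.mem_singleton, ← hM]
        exact Finset.mem_filter.2 ⟨hLS, (hval hLS a y).1 hx⟩
    · rintro (rfl | rfl)
      · exact ⟨Finset.mem_preimage.1 haT,
          (V a).add_mem (hrV a) ((V a).smul_mem y (hpV a))⟩
      · exact ⟨(Finset.mem_filter.1 hMmem.1).1, (hval hMmem.1 a y).2 hMmem.2⟩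
  · rintro ⟨a, y⟩ - ⟨b, z⟩ - h
    obtain ⟨k, hk⟩ := (Projectivization.mk_eq_mk_iff' ℝ _ _ (hpt _ _) (hpt _ _)).1 h
    simp only at hk
    obtain ⟨h1, h2, h3⟩ := hind (k * z - y) (k * b - a) (k - 1) (by
      rw [← sub_eq_zero] at hk
      rw [← hk]; module)
    obtain rfl : k = 1 := by linarith
    obtain rfl : y = z := by linarith
    obtain rfl : a = b := by linarith
    rfl

/-- For a full rank supersolvable real line arrangement,
`|Sing₂(A)| + m(A) ≥ |A|`. -/
theorem card_le_ncard_sing2_add_maxMult (A : Arr ℝ) (hA : IsLineArr A)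
    (hfr : FullRank A) (hss : Supersolvable A) :
    A.card ≤ (Sing2Set A).ncard + maxMult A := by
  obtain ⟨P, hP⟩ := hss
  exact (card_le_ncard_sing2_add_multAt hA hP).trans
    (Nat.add_le_add_left (multAt_le_maxMult hP.1) _)
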